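/- For every vector z : Fin N → ℂ, the real part of ⟨B_{S1} z, z⟩_h is zero (the discrete first-derivative operator is skew with respect to the discrete inner product; this is the key identity in the proof of the semi-discrete energy conservation). -/

import Mathlib

open Matrix Complex BigOperators

noncomputable section

/-- The shifted integer index `k̂ = k - N/2` associated to `k ∈ Fin N`. -/
def khat (N : ℕ) (k : Fin N) : ℤ := (k : ℤ) - (N : ℤ) / 2

/-- The collocation angles `θ_j = 2π ĵ / N`. -/
def theta (N : ℕ) (j : Fin N) : ℝ := 2 * Real.pi * (khat N j : ℝ) / N

/-- The discrete Fourier matrix `F`, `F_{k,j} = (1/N) exp(-i k̂ θ_j)`. -/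
def Fm (N : ℕ) : Matrix (Fin N) (Fin N) ℂ :=
  Matrix.of fun k j => (N : ℂ)⁻¹ * Complex.exp (-Complex.I * (khat N k : ℂ) * (theta N j : ℂ))

/-- The inverse discrete Fourier matrix `G`, `G_{j,k} = exp(i k̂ θ_j)`. -/
def Gm (N : ℕ) : Matrix (Fin N) (Fin N) ℂ :=
  Matrix.of fun j k => Complex.exp (Complex.I * (khat N k : ℂ) * (theta N j : ℂ))

/-- The diagonal weight matrix `P = diag(α - i x_j)`. -/
def Pm (N : ℕ) (α : ℝ) (x : Fin N → ℝ) : Matrix (Fin N) (Fin N) ℂ :=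
  Matrix.diagonal fun j => (α : ℂ) - Complex.I * (x j : ℂ)

/-- The diagonal matrix `P⁻¹ = diag((α - i x_j)⁻¹)`. -/
def PinvM (N : ℕ) (α : ℝ) (x : Fin N → ℝ) : Matrix (Fin N) (Fin N) ℂ :=
  Matrix.diagonal fun j => ((α : ℂ) - Complex.I * (x j : ℂ))⁻¹

/-- The diagonal matrix `P̄ = diag(α + i x_j)`. -/
def PbarM (N : ℕ) (α : ℝ) (x : Fin N → ℝ) : Matrix (Fin N) (Fin N) ℂ :=
  Matrix.diagonal fun j => (α : ℂ) + Complex.I * (x j : ℂ)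

/-- The discrete Hilbert transform matrix `H = diag(-i sgn(k̂))` with `sgn(0) = 1`. -/
def Hm (N : ℕ) : Matrix (Fin N) (Fin N) ℂ :=
  Matrix.diagonal fun k => if 0 ≤ khat N k then -Complex.I else Complex.I

/-- The tridiagonal differentiation matrix `S1`:
`(S1)_{k,k-1} = i k̂/(2α)`, `(S1)_{k,k} = i (2k̂+1)/(2α)`, `(S1)_{k,k+1} = i (k̂+1)/(2α)`. -/
def S1 (N : ℕ) (α : ℝ) : Matrix (Fin N) (Fin N) ℂ :=
  Matrix.of fun k l =>
    if (l : ℤ) = (k : ℤ) - 1 then Complex.I * (khat N k : ℂ) / (2 * (α : ℂ))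
    else if (l : ℤ) = (k : ℤ) then Complex.I * (2 * (khat N k : ℂ) + 1) / (2 * (α : ℂ))
    else if (l : ℤ) = (k : ℤ) + 1 then Complex.I * ((khat N k : ℂ) + 1) / (2 * (α : ℂ))
    else 0

/-- The second-derivative matrix `S2 = S1 · S1`. -/
def S2 (N : ℕ) (α : ℝ) : Matrix (Fin N) (Fin N) ℂ := S1 N α * S1 N α

/-- The discrete inner product `⟨u,v⟩_h = (π/(Nα)) Σ_j (α² + x_j²) u_j conj(v_j)`. -/
def iph (N : ℕ) (α : ℝ) (x : Fin N → ℝ) (u v : Fin N → ℂ) : ℂ :=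
  ((Real.pi / (N * α) : ℝ) : ℂ) *
    ∑ j, ((α ^ 2 + x j ^ 2 : ℝ) : ℂ) * u j * (starRingEnd ℂ) (v j)

/-- The conjugated first-derivative operator `B_{S1} = P⁻¹ G S1 F P`. -/
def BS1 (N : ℕ) (α : ℝ) (x : Fin N → ℝ) : Matrix (Fin N) (Fin N) ℂ :=
  PinvM N α x * Gm N * S1 N α * Fm N * Pm N α x

/-- The conjugated operator `B_{HS1} = P⁻¹ G H S1 F P`. -/
def BHS1 (N : ℕ) (α : ℝ) (x : Fin N → ℝ) : Matrix (Fin N) (Fin N) ℂ :=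
  PinvM N α x * Gm N * Hm N * S1 N α * Fm N * Pm N α x

/-- The conjugated dispersion operator `B_{HS2} = P⁻¹ G H S2 F P`. -/
def BHS2 (N : ℕ) (α : ℝ) (x : Fin N → ℝ) : Matrix (Fin N) (Fin N) ℂ :=
  PinvM N α x * Gm N * Hm N * S2 N α * Fm N * Pm N α x

/-- Coercion of a real vector into a complex vector. -/
def cv (N : ℕ) (u : Fin N → ℝ) : Fin N → ℂ := fun j => (u j : ℂ)

/-- Entrywise `m`-th power of a complex vector. -/
def pw (N : ℕ) (m : ℕ) (u : Fin N → ℂ) : Fin N → ℂ := fun j => u j ^ m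

/-- The mass-conservative semi-discrete right-hand side
`f_M(w) = B_{HS2} w - (1/(m+1)) (w^{∘(m-1)} ⊙ (B_{S1} w) + B_{S1}(w^{∘m}))`. -/
def fM (N : ℕ) (α : ℝ) (x : Fin N → ℝ) (m : ℕ) (w : Fin N → ℂ) : Fin N → ℂ :=
  fun j => (BHS2 N α x *ᵥ w) j
    - (1 / ((m : ℂ) + 1)) *
        ((w j) ^ (m - 1) * (BS1 N α x *ᵥ w) j + (BS1 N α x *ᵥ pw N m w) j)

/-- The energy-conservative semi-discrete right-hand side
`f_E(w) = -B_{S1}(-B_{HS1} w + (1/m) w^{∘m})`. -/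
def fE (N : ℕ) (α : ℝ) (x : Fin N → ℝ) (m : ℕ) (w : Fin N → ℂ) : Fin N → ℂ :=
  -(BS1 N α x *ᵥ (-(BHS1 N α x *ᵥ w) + (1 / (m : ℂ)) • pw N m w))

/-- The semi-discrete energy
`E_h(w) = (1/2)⟨B_{HS1} w, w⟩_h - (1/(m(m+1)))⟨w^{∘m}, w⟩_h`. -/
def Eh (N : ℕ) (α : ℝ) (x : Fin N → ℝ) (m : ℕ) (w : Fin N → ℂ) : ℂ :=
  (1 / 2 : ℂ) * iph N α x (BHS1 N α x *ᵥ w) w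
    - (1 / ((m : ℂ) * ((m : ℂ) + 1))) * iph N α x (pw N m w) w

end

open Matrix in
lemma S1_conjTranspose (N : ℕ) (α : ℝ) : (S1 N α)ᴴ = -S1 N α := by
  ext k l
  simp only [S1, conjTranspose_apply, of_apply, Matrix.neg_apply, khat]
  split_ifs <;> first | omega | skip
  · have h : ((l : ℕ) : ℂ) = ((k : ℕ) : ℂ) + 1 := by
      have : (l : ℕ) = (k : ℕ) + 1 := by omega
      exact_mod_cast this
    simp [h]
    ring
  · have h : l = k := Fin.ext (by omega)
    subst h
    simp
    ring
  · have h : ((k : ℕ) : ℂ) = ((l : ℕ) : ℂ) + 1 := by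
      have : (k : ℕ) = (l : ℕ) + 1 := by omega
      exact_mod_cast this
    simp [h]
    ring
  · simp

open Matrix in
lemma Fm_eq_smul_conjTranspose_Gm (N : ℕ) : Fm N = (N : ℂ)⁻¹ • (Gm N)ᴴ := by
  ext k j
  simp [Fm, Gm, ← Complex.exp_conj]

open Matrix in
lemma conjTranspose_Pm_mul_Pm_mul_PinvM (N : ℕ) {α : ℝ} (hα : 0 < α) (x : Fin N → ℝ) :
    (Pm N α x)ᴴ * Pm N α x * PinvM N α x = (Pm N α x)ᴴ := by
  have h : Pm N α x * PinvM N α x = 1 := by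
    rw [Pm, PinvM, diagonal_mul_diagonal, ← diagonal_one]
    congr 1
    funext j
    refine mul_inv_cancel₀ fun h => hα.ne' ?_
    simpa using congrArg Complex.re h
  rw [Matrix.mul_assoc, h, Matrix.mul_one]

open Matrix in
lemma iph_eq_dotProduct (N : ℕ) (α : ℝ) (x : Fin N → ℝ) (u v : Fin N → ℂ) :
    iph N α x u v = ((Real.pi / (N * α) : ℝ) : ℂ) *
      (star v ⬝ᵥ (((Pm N α x)ᴴ * Pm N α x) *ᵥ u)) := by
  rw [iph, Pm, diagonal_conjTranspose, diagonal_mul_diagonal]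
  congr 1
  refine Finset.sum_congr rfl fun j _ => ?_
  simp only [mulVec_diagonal, Pi.star_apply, star_sub, star_mul', RCLike.star_def,
    Complex.conj_ofReal, Complex.conj_I]
  push_cast
  linear_combination ((x j : ℂ) ^ 2 * u j * (starRingEnd ℂ) (v j)) * Complex.I_sq

open Matrix in
lemma re_star_dotProduct_mulVec_eq_zero {n : Type*} [Fintype n] {M : Matrix n n ℂ}
    (hM : Mᴴ = -M) (z : n → ℂ) : (star z ⬝ᵥ (M *ᵥ z)).re = 0 := by
  have h : star (star z ⬝ᵥ (M *ᵥ z)) = -(star z ⬝ᵥ (M *ᵥ z)) := by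
    rw [← star_dotProduct, star_mulVec, hM, ← dotProduct_mulVec, neg_mulVec,
      dotProduct_neg]
  have := congrArg Complex.re h
  simp only [RCLike.star_def, Complex.conj_re, Complex.neg_re] at this
  linarith

open Matrix in
/-- The discrete first-derivative operator `B_{S1}` is skew with respect to the
discrete inner product: `Re ⟨B_{S1} z, z⟩_h = 0` for every `z : Fin N → ℂ`. -/
theorem re_iph_BS1_eq_zero (N : ℕ) (hN : Even N) (hN0 : 0 < N)
    (α : ℝ) (hα : 0 < α) (x : Fin N → ℝ) (z : Fin N → ℂ) :
    (iph N α x (BS1 N α x *ᵥ z) z).re = 0 := by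
  have hB : (Pm N α x)ᴴ * Pm N α x * BS1 N α x =
      (N : ℂ)⁻¹ • (((Gm N)ᴴ * Pm N α x)ᴴ * S1 N α * ((Gm N)ᴴ * Pm N α x)) := by
    rw [BS1, Fm_eq_smul_conjTranspose_Gm]
    simp only [← Matrix.mul_assoc]
    rw [conjTranspose_Pm_mul_Pm_mul_PinvM N hα]
    simp [Matrix.mul_assoc]
  rw [iph_eq_dotProduct, mulVec_mulVec, hB, Complex.re_ofReal_mul,
    re_star_dotProduct_mulVec_eq_zero, mul_zero]
  simp [conjTranspose_mul, S1_conjTranspose, Matrix.mul_assoc]
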